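/- Let O₁ and O₀ be nonempty open subsets of ℝ^N such that the closure of O₁ is compact and contained in O₀. Then there exist a smooth (C^∞) function ξ : ℝ^N → ℝ with compact support contained in O₀ and a constant M > 0 such that: 0 ≤ ξ(x) ≤ 1 for all x; ξ(x) = 1 for all x ∈ O₁; ‖∇ξ(x)‖ ≤ M·√(ξ(x)) for all x ∈ ℝ^N; and |Δξ(x)| ≤ M·√(ξ(x)) for all x ∈ ℝ^N, where Δξ denotes the Laplacian of ξ, i.e. the sum over i = 1,…,N of the second partial derivatives ∂²ξ/∂xᵢ². -/

import Mathlib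

/-- The sum of the second partial derivatives (the Laplacian)
`Δf(x) = ∑ i, ∂²f/∂xᵢ²(x)` of a function `f : ℝ^N → ℝ`. -/
noncomputable def secondPartialSum (N : ℕ) (f : EuclideanSpace ℝ (Fin N) → ℝ)
    (x : EuclideanSpace ℝ (Fin N)) : ℝ :=
  ∑ i : Fin N,
    fderiv ℝ (fun y => fderiv ℝ f y (EuclideanSpace.single i (1 : ℝ))) x
      (EuclideanSpace.single i (1 : ℝ))

/-- Let `O₁`, `O₀` be nonempty open subsets of `ℝ^N` with `closure O₁` compact and
contained in `O₀`. Then there exist a smooth function `ξ` with compact support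
contained in `O₀` and a constant `M > 0` such that `0 ≤ ξ ≤ 1`, `ξ = 1` on `O₁`,
`‖∇ξ‖ ≤ M·√ξ` and `|Δξ| ≤ M·√ξ`. -/
theorem stmt_12 (N : ℕ) (hN : 1 ≤ N)
    (O₀ O₁ : Set (EuclideanSpace ℝ (Fin N)))
    (hO₀ : IsOpen O₀) (hO₁ : IsOpen O₁)
    (hne₀ : O₀.Nonempty) (hne₁ : O₁.Nonempty)
    (hcpt : IsCompact (closure O₁)) (hsub : closure O₁ ⊆ O₀) :
    ∃ (ξ : EuclideanSpace ℝ (Fin N) → ℝ) (M : ℝ), 0 < M ∧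
      ContDiff ℝ (⊤ : ℕ∞) ξ ∧ HasCompactSupport ξ ∧ tsupport ξ ⊆ O₀ ∧
      (∀ x, 0 ≤ ξ x ∧ ξ x ≤ 1) ∧
      (∀ x ∈ O₁, ξ x = 1) ∧
      (∀ x, ‖gradient ξ x‖ ≤ M * Real.sqrt (ξ x)) ∧
      (∀ x, |secondPartialSum N ξ x| ≤ M * Real.sqrt (ξ x)) := by
  obtain ⟨V, hV, hKV, hVO, hVc⟩ := exists_open_between_and_isCompact_closure hcpt hO₀ hsub
  obtain ⟨η, hη, hr, hs, h1⟩ := exists_contMDiff_support_eq_eq_one_iff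
    (modelWithCornersSelf ℝ (EuclideanSpace ℝ (Fin N))) hV isClosed_closure hKV
  have hηd : ContDiff ℝ (⊤ : ℕ∞) η := hη.contDiff
  have h0 : ∀ x, 0 ≤ η x := fun x => (hr ⟨x, rfl⟩).1
  have h1' : ∀ x, η x ≤ 1 := fun x => (hr ⟨x, rfl⟩).2
  have hts : tsupport η = closure V := by rw [tsupport, hs]
  have hηc : HasCompactSupport η := by rw [HasCompactSupport, hts]; exact hVc
  have hdiff : Differentiable ℝ η := hηd.differentiable (by simp)
  have hfd : ContDiff ℝ (⊤ : ℕ∞) (fderiv ℝ η) := hηd.fderiv_right (by simp)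
  have hpd : ∀ v, ContDiff ℝ (⊤ : ℕ∞) (fun y => fderiv ℝ η y v) :=
    fun v => hfd.clm_apply contDiff_const
  have hpdd : ∀ v, Continuous (fun y => fderiv ℝ (fun y => fderiv ℝ η y v) y v) :=
    fun v => ((hpd v).fderiv_right (m := (⊤ : ℕ∞)) (by simp)).continuous.clm_apply
      continuous_const
  -- first derivative of the fourth power
  have hF : ∀ x, fderiv ℝ (fun y => η y ^ 4) x = (4 * η x ^ 3) • fderiv ℝ η x := by
    intro x
    have := (((hdiff x).hasFDerivAt).pow 4).fderiv
    simpa using this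
  have hS : ∀ v x, fderiv ℝ (fun y => fderiv ℝ (fun y => η y ^ 4) y v) x v
      = η x ^ 2 * (12 * (fderiv ℝ η x v) ^ 2
        + 4 * η x * fderiv ℝ (fun y => fderiv ℝ η y v) x v) := by
    intro v x
    have e : (fun y => fderiv ℝ (fun y => η y ^ 4) y v)
        = fun y => (4 * η y ^ 3) * fderiv ℝ η y v := by
      funext y; rw [hF]; simp
    rw [e]
    have hd2 : HasFDerivAt (fun y => fderiv ℝ η y v) _ x :=
      ((hpd v).differentiable (by simp) x).hasFDerivAt
    have := ((((hdiff x).hasFDerivAt).pow 3).const_mul 4).mul hd2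
    have this2 := HasFDerivAt.fderiv this
    change fderiv ℝ (fun y => 4 * η y ^ 3 * (fderiv ℝ η y) v) x = _ at this2
    rw [this2]
    simp
    ring
  obtain ⟨C₁, hC₁⟩ := hVc.exists_bound_of_continuousOn
    (f := fun x => 4 * η x * ‖fderiv ℝ η x‖)
    ((continuous_const.mul hηd.continuous).mul hfd.continuous.norm).continuousOn
  obtain ⟨C₂, hC₂⟩ := hVc.exists_bound_of_continuousOn
    (f := fun x => ∑ i : Fin N, (12 * (fderiv ℝ η x (EuclideanSpace.single i (1 : ℝ))) ^ 2
        + 4 * η x * fderiv ℝ (fun y => fderiv ℝ η y (EuclideanSpace.single i (1 : ℝ))) x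
          (EuclideanSpace.single i (1 : ℝ))))
    (continuous_finsetSum _ fun i _ => (continuous_const.mul ((hpd _).continuous.pow 2)).add
      ((continuous_const.mul hηd.continuous).mul (hpdd _))).continuousOn
  have hz : ∀ x, x ∉ closure V → η x = 0 := fun x hx => by
    rw [← hts] at hx; exact image_eq_zero_of_notMem_tsupport hx
  have hsq : ∀ x, Real.sqrt (η x ^ 4) = η x ^ 2 := fun x => by
    rw [show η x ^ 4 = (η x ^ 2) ^ 2 by ring]; exact Real.sqrt_sq (sq_nonneg _)
  have hsupp : tsupport (fun y => η y ^ 4) ⊆ tsupport η := by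
    apply closure_mono
    intro x hx hx'
    apply hx
    simp [hx']
  refine ⟨fun y => η y ^ 4, max 1 (max C₁ C₂), by positivity, hηd.pow 4, ?_,
    hsupp.trans (hts ▸ hVO), fun x => ⟨pow_nonneg (h0 x) 4, pow_le_one₀ (h0 x) (h1' x)⟩,
    ?_, ?_, ?_⟩
  · exact hηc.of_isClosed_subset (isClosed_tsupport _) hsupp
  · intro x hx
    have : η x = 1 := (h1 x).1 (subset_closure hx)
    simp [this]
  · intro x
    simp only [hsq]
    rw [gradient, LinearIsometryEquiv.norm_map, hF, norm_smul, Real.norm_eq_abs,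
      abs_of_nonneg (by have := h0 x; positivity)]
    by_cases hx : x ∈ closure V
    · have h := (le_abs_self _).trans (hC₁ x hx)
      have h' : 4 * η x * ‖fderiv ℝ η x‖ ≤ max 1 (max C₁ C₂) :=
        h.trans ((le_max_left _ _).trans (le_max_right _ _))
      nlinarith [mul_le_mul_of_nonneg_right h' (sq_nonneg (η x))]
    · simp [hz x hx]
  · intro x
    simp only [hsq, secondPartialSum, hS]
    rw [← Finset.mul_sum, abs_mul, abs_of_nonneg (sq_nonneg (η x)), mul_comm]
    by_cases hx : x ∈ closure V
    · exact mul_le_mul_of_nonneg_right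
        ((hC₂ x hx).trans ((le_max_right _ _).trans (le_max_right _ _))) (sq_nonneg _)
    · simp [hz x hx]
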